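/- Let N, N' be non-negative integers with N + N' ≥ 1, let R_1,…,R_N ∈ [0,1) and R'_1,…,R'_{N'} ∈ (0,1), and fix ε > 0. For each i = 1,…,N let c_{i,τ} : [R_i,1] → (0,∞), τ ∈ (−ε,ε), and for each j = 1,…,N' let c'_{j,τ} : [R'_j,1] → (0,∞), τ ∈ (−ε,ε), be families of C^{1,1} functions, each satisfying the Herglotz condition and the countable conjugacy condition, such that each map (τ,r) ↦ c_{i,τ}(r) (respectively c'_{j,τ}(r)) is continuous, differentiable in τ with jointly continuous τ-derivative; whenever R_i = 0 assume additionally c_{i,τ}'(0) = 0 for all τ. If the set ⋃_{i=1}^N lsp(c_{i,τ}) ∪ ⋃_{j=1}^{N'} lsp'(c'_{j,τ}) is the same for every τ ∈ (−ε,ε), then c_{i,τ} = c_{i,0} for every i and τ, and c'_{j,τ} = c'_{j,0} for every j and τ. -/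

import Mathlib

/-- `c` is `C^{1,1}` on `[R,1]`: differentiable with Lipschitz derivative. -/
def IsC11On (c : ℝ → ℝ) (R : ℝ) : Prop :=
  ∃ c' : ℝ → ℝ, ∃ K : NNReal,
    (∀ r ∈ Set.Icc R 1, HasDerivWithinAt c (c' r) (Set.Icc R 1) r) ∧
    LipschitzOnWith K c' (Set.Icc R 1)

/-- The Herglotz condition: `d/dr (r / c r) > 0` on `[R,1]`. -/
def HerglotzCond (c : ℝ → ℝ) (R : ℝ) : Prop :=
  ∀ r ∈ Set.Icc R 1, 0 < derivWithin (fun s => s / c s) (Set.Icc R 1) r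

/-- Half length `L(r)` of the maximal geodesic of radius `r`. -/
noncomputable def Lfun (c : ℝ → ℝ) (r : ℝ) : ℝ :=
  ∫ s in r..1, (c s)⁻¹ * (Real.sqrt (1 - (r * c s / (s * c r)) ^ 2))⁻¹

/-- Half of the angular distance `α(r)` between the endpoints of the maximal geodesic
of radius `r`. -/
noncomputable def alphaFun (c : ℝ → ℝ) (r : ℝ) : ℝ :=
  ∫ s in r..1, (r * c s) / (c r * s ^ 2) * (Real.sqrt (1 - (r * c s / (s * c r)) ^ 2))⁻¹

/-- The length spectrum (without inner reflections): lengths `2 n L(r)` of periodic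
broken rays, where the broken ray of radius `r` closes up after `n` reflections and
`m` windings, `n, m` coprime positive integers with `n α(r) = m π`. -/
noncomputable def lsp (c : ℝ → ℝ) (R : ℝ) : Set ℝ :=
  {ℓ | ∃ r ∈ Set.Ioo R 1, ∃ n m : ℕ, 0 < n ∧ 0 < m ∧ Nat.Coprime n m ∧
        (n : ℝ) * alphaFun c r = (m : ℝ) * Real.pi ∧ ℓ = 2 * (n : ℝ) * Lfun c r}

/-- The angular advance `β(z)` of a geodesic segment from the inner boundary `r = R`
to the outer boundary `r = 1` with angular momentum `z`. -/
noncomputable def betaFun (c : ℝ → ℝ) (R : ℝ) (z : ℝ) : ℝ :=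
  ∫ r in R..1, (z * c r / r ^ 2) * (Real.sqrt (1 - (z * c r / r) ^ 2))⁻¹

/-- The travel time `T(z)` of a geodesic segment from the inner boundary to the outer
boundary with angular momentum `z`. -/
noncomputable def Tfun (c : ℝ → ℝ) (R : ℝ) (z : ℝ) : ℝ :=
  ∫ r in R..1, (c r)⁻¹ * (Real.sqrt (1 - (z * c r / r) ^ 2))⁻¹

/-- The length spectrum including broken rays reflecting at the inner boundary. -/
noncomputable def lsp' (c : ℝ → ℝ) (R : ℝ) : Set ℝ :=
  lsp c R ∪
    {ℓ | ∃ z : ℝ, 0 < z ∧ z < R / c R ∧ ∃ n m : ℕ, 0 < n ∧ 0 < m ∧ Nat.Coprime n m ∧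
      (n : ℝ) * betaFun c R z = (m : ℝ) * Real.pi ∧ ℓ = 2 * (n : ℝ) * Tfun c R z}


namespace HelperProofs
open Set Filter Topology MeasureTheory

theorem K_int (a b : ℝ) : IntervalIntegrable (fun s : ℝ => (√|s|)⁻¹) volume a b := by
  have key : ∀ b : ℝ, 0 ≤ b → IntervalIntegrable (fun s : ℝ => (√|s|)⁻¹) volume 0 b := by
    intro b hb
    have h := intervalIntegral.intervalIntegrable_rpow' (a := 0) (b := b) (r := -(1/2)) (by norm_num)
    refine h.congr ?_
    intro x hx
    rw [uIoc_of_le hb] at hx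
    simp only
    rw [abs_of_pos hx.1, Real.rpow_neg hx.1.le, Real.sqrt_eq_rpow]
  have key2 : ∀ b : ℝ, IntervalIntegrable (fun s : ℝ => (√|s|)⁻¹) volume 0 b := by
    intro b
    rcases le_total 0 b with hb | hb
    · exact key b hb
    · have := (key (-b) (by linarith)).comp_sub_left 0
      simp only [zero_sub, abs_neg, sub_zero, neg_neg] at this
      simpa using this
  exact (key2 a).symm.trans (key2 b)

theorem Kr_int (κ r a b : ℝ) : IntervalIntegrable (fun s : ℝ => (√(κ * |s - r|))⁻¹) volume a b := by
  by_cases hκ : κ ≤ 0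
  · have : (fun s : ℝ => (√(κ * |s - r|))⁻¹) = fun _ => 0 := by
      funext s
      rw [Real.sqrt_eq_zero_of_nonpos (mul_nonpos_of_nonpos_of_nonneg hκ (abs_nonneg _)), inv_zero]
    rw [this]; exact intervalIntegrable_const
  push Not at hκ
  have h := ((K_int (a - r) (b - r)).comp_sub_right r).const_mul ((√κ)⁻¹)
  simp only [sub_add_cancel] at h
  refine h.congr ?_
  intro x _
  simp only
  rw [Real.sqrt_mul hκ.le, mul_inv]

theorem sqrt_diff (x b : ℝ) (hb : b ≠ 0) : |√x - √b| ≤ |x - b| * (√|b|)⁻¹ := by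
  have hb' : 0 < √|b| := Real.sqrt_pos.2 (abs_pos.2 hb)
  rw [← div_eq_mul_inv, le_div_iff₀ hb']
  rcases lt_or_gt_of_ne hb with h | h
  · rw [Real.sqrt_eq_zero_of_nonpos h.le, sub_zero, abs_of_nonneg (Real.sqrt_nonneg _), abs_of_neg h]
    rcases le_total x 0 with hx | hx
    · rw [Real.sqrt_eq_zero_of_nonpos hx]; simp
    · rw [abs_of_nonneg (by linarith)]
      have h1 := Real.sq_sqrt hx
      have h2 := Real.sq_sqrt (by linarith : 0 ≤ -b)
      nlinarith [sq_nonneg (√x - √(-b)), Real.sqrt_nonneg x, Real.sqrt_nonneg (-b)]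
  · rw [abs_of_pos h]
    rcases le_total x 0 with hx | hx
    · rw [Real.sqrt_eq_zero_of_nonpos hx, zero_sub, abs_neg, abs_of_nonneg (Real.sqrt_nonneg _),
        abs_of_nonpos (by linarith), Real.mul_self_sqrt h.le]; linarith
    · have h1 := Real.sq_sqrt hx
      have h2 := Real.sq_sqrt h.le
      have : x - b = (√x - √b) * (√x + √b) := by nlinarith
      rw [this, abs_mul, abs_of_nonneg (by positivity : 0 ≤ √x + √b)]
      gcongr
      linarith [Real.sqrt_nonneg x]

theorem growth_abs {q : ℝ → ℝ} {a κ : ℝ} 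
    (hq : ∀ s t, a ≤ s → s ≤ t → t ≤ 1 → κ * (t - s) ≤ q t - q s) {r s : ℝ}
    (hr : r ∈ Icc a 1) (hs : s ∈ Icc a 1) : κ * |s - r| ≤ |q s - q r| := by
  rcases le_total r s with h | h
  · rw [abs_of_nonneg (by linarith : 0 ≤ s - r)]
    exact (hq r s hr.1 h hs.2).trans (le_abs_self _)
  · rw [abs_sub_comm, abs_sub_comm (q s), abs_of_nonneg (by linarith : 0 ≤ r - s)]
    exact (hq s r hs.1 h hr.2).trans (le_abs_self _)

/-- differentiation under the integral with a moving square root singularity -/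
theorem deriv_sqrt_int {q : ℝ → ℝ} {a κ : ℝ} (ha : a < 1) (hκ : 0 < κ) (hqc : Continuous q)
    (hq : ∀ s t, a ≤ s → s ≤ t → t ≤ 1 → κ * (t - s) ≤ q t - q s) {r : ℝ} (hr : r ∈ Icc a 1)
    {g : ℝ → ℝ} (hg : Continuous g) {B : ℝ → ℝ → ℝ} {B' : ℝ → ℝ} {t0 C δ : ℝ} (hδ : 0 < δ)
    (hBc : ∀ t, Continuous (B t)) (hB'c : Continuous B')
    (hB0 : ∀ s, B t0 s = q s - q r)
    (hlip : ∀ t ∈ Metric.ball t0 δ, ∀ s ∈ Icc a 1, |B t s - B t0 s| ≤ C * |t - t0|)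
    (hder : ∀ s ∈ Icc a 1, HasDerivAt (fun t => B t s) (B' s) t0) :
    HasDerivAt (fun t => ∫ s in a..1, g s * √(B t s))
      (∫ s in a..1, g s * (B' s / 2 * (√(q s - q r))⁻¹)) t0 := by
  obtain ⟨G, hG⟩ := isCompact_Icc.exists_bound_of_continuousOn (s := Icc a 1) hg.continuousOn
  have hG0 : 0 ≤ G := (norm_nonneg _).trans (hG r hr)
  have hC0 : 0 ≤ C := by
    have h := hlip (t0 + δ/2) (by simp [abs_of_pos hδ]; linarith) r hr
    have h2 := (abs_nonneg _).trans h
    have : 0 < |t0 + δ/2 - t0| := by rw [add_sub_cancel_left, abs_of_pos (by linarith)]; linarith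
    exact nonneg_of_mul_nonneg_left h2 this
  have hne : ∀ᵐ s ∂(volume.restrict (Ioc a 1)), s ∈ Icc a 1 ∧ s ≠ r := by
    refine Filter.Eventually.and ?_ ?_
    · filter_upwards [ae_restrict_mem measurableSet_Ioc] with s hs using ⟨hs.1.le, hs.2⟩
    · exact ae_restrict_of_ae (Measure.ae_ne volume r)
  have hpos : ∀ s, s ∈ Icc a 1 → s ≠ r → 0 < κ * |s - r| := fun s _ h =>
    mul_pos hκ (abs_pos.2 (sub_ne_zero.2 h))
  have hqne : ∀ s, s ∈ Icc a 1 → s ≠ r → q s - q r ≠ 0 := fun s hs h => by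
    have := (hpos s hs h).trans_le (growth_abs hq hr hs)
    exact abs_pos.1 this
  have := hasFDerivAt_integral_of_dominated_loc_of_lip' (μ := volume.restrict (Ioc a 1)) (𝕜 := ℝ)
    (F := fun t s => g s * √(B t s)) (x₀ := t0)
    (F' := fun s => ContinuousLinearMap.toSpanSingleton ℝ (g s * (B' s / 2 * (√(q s - q r))⁻¹)))
    (bound := fun s => G * C * (√(κ * |s - r|))⁻¹) (Metric.ball_mem_nhds t0 hδ)
    (fun t _ => (hg.mul (hBc t).sqrt).aestronglyMeasurable)
    (((hg.mul (hBc t0).sqrt).intervalIntegrable a 1).1)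
    (by
      have hm : Measurable (fun s => g s * (B' s / 2 * (√(q s - q r))⁻¹)) := by
        have := hg.measurable; have := hB'c.measurable; have := hqc.measurable
        fun_prop
      exact ((ContinuousLinearMap.toSpanSingletonCLE (𝕜 := ℝ) (E := ℝ)).continuous.comp_aestronglyMeasurable hm.aestronglyMeasurable))
    (by
      filter_upwards [hne] with s ⟨hs, hsr⟩ t ht
      rw [← mul_sub, norm_mul, Real.norm_eq_abs, Real.norm_eq_abs, Real.norm_eq_abs]
      have h1 := sqrt_diff (B t s) (B t0 s) (by rw [hB0]; exact hqne s hs hsr)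
      have h2 := hlip t ht s hs
      have h3 : (√|B t0 s|)⁻¹ ≤ (√(κ * |s - r|))⁻¹ := by
        rw [hB0]
        have := hpos s hs hsr
        have := Real.sqrt_pos.2 this
        gcongr
        exact growth_abs hq hr hs
      calc |g s| * |√(B t s) - √(B t0 s)| ≤ G * (C * |t - t0| * (√(κ * |s - r|))⁻¹) := by
            have := hG s hs
            rw [Real.norm_eq_abs] at this
            refine mul_le_mul this (h1.trans ?_) (abs_nonneg _) hG0
            gcongr
        _ = _ := by ring)
    ((Kr_int κ r a 1).const_mul (G * C)).1
    (by
      filter_upwards [hne] with s ⟨hs, hsr⟩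
      have h := ((hder s hs).sqrt (by rw [hB0]; exact hqne s hs hsr)).const_mul (g s)
      rw [hB0] at h
      have he : g s * (B' s / 2 * (√(q s - q r))⁻¹) = g s * (B' s / (2 * √(q s - q r))) := by
        rw [div_mul_eq_div_div, div_eq_mul_inv (B' s / 2)]
      rw [he]
      exact h.hasFDerivAt)
  have h2 := this.2.hasDerivAt
  have h3 := this.1
  simp only [intervalIntegral.integral_of_le ha.le]
  rw [ContinuousLinearMap.integral_apply h3] at h2
  simpa using h2

theorem envelope {H : ℝ → ℝ → ℝ} (hH : Continuous (fun x : ℝ × ℝ => H x.1 x.2)) {z1 z2 τ0 d1 d2 : ℝ} (hz : z1 < z2)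
    (h1 : HasDerivAt (H τ0) d1 z1) (hd1 : d1 < 0) (h2 : HasDerivAt (H τ0) d2 z2) (hd2 : 0 < d2)
    {S : Set ℝ} (hS : S.Countable)
    (hcrit : ∀ᶠ τ in 𝓝 τ0, ∀ z ∈ Ioo z1 z2, IsLocalMin (H τ) z → H τ z ∈ S) :
    ∃ z0 ∈ Ioo z1 z2, IsLocalMin (fun τ => H τ z0) τ0 := by
  have hHz : ∀ τ, Continuous (H τ) := fun τ => by fun_prop
  have hHt : ∀ z, Continuous (fun τ => H τ z) := fun z => hH.comp (by fun_prop : Continuous fun τ : ℝ => (τ, z))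
  have hne : (Icc z1 z2).Nonempty := nonempty_Icc.2 hz.le
  have hmin : ∀ τ, ∃ z ∈ Icc z1 z2, IsMinOn (H τ) (Icc z1 z2) z := fun τ =>
    isCompact_Icc.exists_isMinOn hne (hHz τ).continuousOn
  -- smaller values close to the end points
  have e1 : ∃ z ∈ Ioo z1 z2, H τ0 z < H τ0 z1 := by
    have := (hasDerivAt_iff_tendsto_slope.1 h1).mono_left (nhdsGT_le_nhdsNE z1)
    have h3 := (this.eventually_lt_const hd1).and (Ioo_mem_nhdsGT hz)
    obtain ⟨z, hz3, hz4⟩ := h3.exists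
    refine ⟨z, hz4, ?_⟩
    rw [slope_def_field, div_neg_iff] at hz3
    rcases hz3 with h | h <;> linarith [hz4.1, h.1, h.2]
  have e2 : ∃ z ∈ Ioo z1 z2, H τ0 z < H τ0 z2 := by
    have := (hasDerivAt_iff_tendsto_slope.1 h2).mono_left (nhdsLT_le_nhdsNE z2)
    have h3 := (this.eventually_const_lt hd2).and (Ioo_mem_nhdsLT hz)
    obtain ⟨z, hz3, hz4⟩ := h3.exists
    refine ⟨z, hz4, ?_⟩
    rw [slope_def_field, div_pos_iff] at hz3
    rcases hz3 with h | h <;> linarith [hz4.2, h.1, h.2]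
  obtain ⟨z0, hz0, hm0⟩ := hmin τ0
  have l1 : H τ0 z0 < H τ0 z1 := by
    obtain ⟨z, hz, h⟩ := e1
    exact (hm0 (Ioo_subset_Icc_self hz)).trans_lt h
  have l2 : H τ0 z0 < H τ0 z2 := by
    obtain ⟨z, hz, h⟩ := e2
    exact (hm0 (Ioo_subset_Icc_self hz)).trans_lt h
  have hz0' : z0 ∈ Ioo z1 z2 := by
    refine ⟨lt_of_le_of_ne hz0.1 ?_, lt_of_le_of_ne hz0.2 ?_⟩
    · rintro rfl; exact lt_irrefl _ l1
    · rintro rfl; exact lt_irrefl _ l2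
  refine ⟨z0, hz0', ?_⟩
  set M : ℝ → ℝ := fun τ => sInf (H τ '' Icc z1 z2) with hM
  have hMc : Continuous M := isCompact_Icc.continuous_sInf hH
  have hMval : ∀ τ z, z ∈ Icc z1 z2 → IsMinOn (H τ) (Icc z1 z2) z → M τ = H τ z := by
    intro τ z hz hm
    refine IsLeast.csInf_eq ⟨mem_image_of_mem _ hz, ?_⟩
    rintro _ ⟨y, hy, rfl⟩
    exact hm hy
  have ev1 : ∀ᶠ τ in 𝓝 τ0, H τ z0 < H τ z1 := (hHt z0).continuousAt.eventually_lt (hHt z1).continuousAt l1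
  have ev2 : ∀ᶠ τ in 𝓝 τ0, H τ z0 < H τ z2 := (hHt z0).continuousAt.eventually_lt (hHt z2).continuousAt l2
  obtain ⟨δ, hδ, hball⟩ := Metric.eventually_nhds_iff_ball.1 (hcrit.and (ev1.and ev2))
  have hMS : M '' Metric.ball τ0 δ ⊆ S := by
    rintro _ ⟨τ, hτ, rfl⟩
    obtain ⟨hc, a1, a2⟩ := hball τ hτ
    obtain ⟨z, hz, hm⟩ := hmin τ
    rw [hMval τ z hz hm]
    have hle : H τ z ≤ H τ z0 := hm hz0
    have hz' : z ∈ Ioo z1 z2 := by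
      refine ⟨lt_of_le_of_ne hz.1 ?_, lt_of_le_of_ne hz.2 ?_⟩
      · rintro rfl; linarith
      · rintro rfl; linarith
    exact hc z hz' (hm.isLocalMin (Icc_mem_nhds hz'.1 hz'.2))
  have hsub : (M '' Metric.ball τ0 δ).Subsingleton :=
    hS.isTotallyDisconnected _ hMS
      ((convex_ball τ0 δ).isPreconnected.image _ hMc.continuousOn)
  filter_upwards [Metric.ball_mem_nhds τ0 hδ] with τ hτ
  have := hsub (mem_image_of_mem M hτ) (mem_image_of_mem M (Metric.mem_ball_self hδ))
  rw [hMval τ0 z0 hz0 hm0] at this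
  obtain ⟨z, hz, hm⟩ := hmin τ
  rw [hMval τ z hz hm] at this
  rw [← this]
  exact hm hz0

theorem abel_cont {q h : ℝ → ℝ} {a κ : ℝ} (ha0 : 0 < a) (hκ : 0 < κ) (hqc : Continuous q)
    (hh : Continuous h)
    (hq : ∀ s t, a ≤ s → s ≤ t → t ≤ 1 → κ * (t - s) ≤ q t - q s) {r0 : ℝ} (hr0 : r0 ∈ Ioo a 1) :
    ContinuousAt (fun r => ∫ s in a..1, h s * (√(q s - q r))⁻¹) r0 := by
  obtain ⟨G, hG⟩ := isCompact_Icc.exists_bound_of_continuousOn (s := Icc a 1) hh.continuousOn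
  have hG0 : 0 ≤ G := (norm_nonneg _).trans (hG r0 (Ioo_subset_Icc_self hr0))
  set F : ℝ → ℝ → ℝ := fun r x => (Iio (1 - r)).indicator (fun x => h (r + x) * (√(q (r + x) - q r))⁻¹) x with hF
  have hIoo : Ioo a 1 ∈ 𝓝 r0 := isOpen_Ioo.mem_nhds hr0
  have heq : ∀ r ∈ Ioo a 1, (∫ s in a..1, h s * (√(q s - q r))⁻¹) = ∫ x, F r x ∂(volume.restrict (Ioc 0 1)) := by
    intro r hr
    have hintg : (fun s => (Ioc a 1).indicator (fun s => h s * (√(q s - q r))⁻¹) s) =ᵐ[volume]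
        fun s => (Ioc 0 1).indicator (F r) (s - r) := by
      filter_upwards [Measure.ae_ne volume (1:ℝ)] with s hs1
      simp only [hF, indicator_apply, mem_Ioc, mem_Iio, add_sub_cancel]
      by_cases h1 : a < s ∧ s ≤ 1
      · rw [if_pos h1]
        by_cases h2 : r < s
        · have : s < 1 := lt_of_le_of_ne h1.2 hs1
          rw [if_pos ⟨by linarith, by linarith [hr.1]⟩, if_pos (by linarith)]
        · push Not at h2
          rw [if_neg (by intro h; linarith [h.1])]
          have := hq s r h1.1.le h2 hr.2.le
          have h3 : q s - q r ≤ 0 := by nlinarith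
          rw [Real.sqrt_eq_zero_of_nonpos h3]; simp
      · rw [if_neg h1]
        by_cases h2 : 0 < s - r ∧ s - r ≤ 1
        · rw [if_pos h2, if_neg]
          intro h3
          exact h1 ⟨by linarith [hr.1], by linarith⟩
        · rw [if_neg h2]
    rw [intervalIntegral.integral_of_le (hr.1.trans hr.2).le, ← integral_indicator measurableSet_Ioc,
      integral_congr_ae hintg, integral_sub_right_eq_self, integral_indicator measurableSet_Ioc]
  refine ContinuousAt.congr ?_ (Filter.eventuallyEq_of_mem hIoo fun r hr => (heq r hr).symm)
  have hgrow : ∀ r ∈ Ioo a 1, ∀ x, 0 < x → x < 1 - r → κ * |x - 0| ≤ q (r + x) - q r := by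
    intro r hr x hx hx1
    have := hq r (r + x) hr.1.le (by linarith) (by linarith)
    rw [sub_zero, abs_of_pos hx]; linarith
  refine continuousAt_of_dominated (bound := fun x => G * (√(κ * |x - 0|))⁻¹) ?_ ?_ ?_ ?_
  · refine Filter.Eventually.of_forall fun r => ?_
    refine Measurable.aestronglyMeasurable ?_
    refine Measurable.indicator ?_ measurableSet_Iio
    have := hqc.measurable; have := hh.measurable
    fun_prop
  · filter_upwards [hIoo] with r hr
    filter_upwards [ae_restrict_mem measurableSet_Ioc] with x hx
    simp only [hF]
    by_cases h1 : x ∈ Iio (1 - r)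
    · rw [indicator_of_mem h1, norm_mul, norm_inv, Real.norm_of_nonneg (Real.sqrt_nonneg _)]
      have h2 := hgrow r hr x hx.1 h1
      have h3 : 0 < √(κ * |x - 0|) := Real.sqrt_pos.2 (mul_pos hκ (by simpa using hx.1.ne'))
      have h4 := hG (r + x) ⟨by linarith [hr.1, hx.1], by linarith [mem_Iio.1 h1]⟩
      gcongr
    · rw [indicator_of_notMem h1]; simp only [norm_zero]; positivity
  · exact ((Kr_int κ 0 0 1).const_mul G).1
  · filter_upwards [ae_restrict_mem measurableSet_Ioc, ae_restrict_of_ae (Measure.ae_ne volume (1 - r0))] with x hx hxne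
    rcases lt_or_gt_of_ne hxne with h1 | h1
    · have hev : ∀ᶠ r in 𝓝 r0, h (r + x) * (√(q (r + x) - q r))⁻¹ = F r x := by
        have : ∀ᶠ r in 𝓝 r0, r < 1 - x := Iio_mem_nhds (by linarith)
        filter_upwards [this] with r hr
        simp only [hF]; rw [indicator_of_mem (by simp only [mem_Iio]; linarith)]
      refine ContinuousAt.congr ?_ hev
      have h2 := hgrow r0 hr0 x hx.1 h1
      have h3 : 0 < κ * |x - 0| := mul_pos hκ (by simpa using hx.1.ne')
      have h4 : √(q (r0 + x) - q r0) ≠ 0 := (Real.sqrt_pos.2 (by linarith)).ne'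
      refine ContinuousAt.mul (by fun_prop) (ContinuousAt.inv₀ (by fun_prop) h4)
    · have hev : ∀ᶠ r in 𝓝 r0, 0 = F r x := by
        have : ∀ᶠ r in 𝓝 r0, 1 - x < r := Ioi_mem_nhds (by linarith)
        filter_upwards [this] with r hr
        simp only [hF]; rw [indicator_of_notMem (by simp only [mem_Iio]; linarith)]
      exact continuousAt_const.congr hev

noncomputable def phiK (x : ℝ) : ℝ := (√x)⁻¹ * (√(1 - x))⁻¹

theorem phiK_nonneg (x : ℝ) : 0 ≤ phiK x := by unfold phiK; positivity

theorem phiK_int : Integrable phiK := by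
  have h1 : Integrable ((Ioc (0:ℝ) 1).indicator (fun x => √2 * ((√|x|)⁻¹ + (√(1 * |x - 1|))⁻¹))) := by
    rw [integrable_indicator_iff measurableSet_Ioc]
    exact (((K_int 0 1).add (Kr_int 1 1 0 1)).const_mul _).1
  refine h1.mono' ?_ ?_
  · refine Measurable.aestronglyMeasurable ?_
    unfold phiK; fun_prop
  · refine Filter.Eventually.of_forall fun x => ?_
    rw [Real.norm_of_nonneg (phiK_nonneg x)]
    unfold phiK
    by_cases hx : x ∈ Ioc (0:ℝ) 1
    · rw [indicator_of_mem hx]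
      rw [abs_of_pos hx.1, one_mul, abs_sub_comm, abs_of_nonneg (by linarith [hx.2] : 0 ≤ 1 - x)]
      have key : ∀ y : ℝ, 1/2 ≤ y → (√y)⁻¹ ≤ √2 := by
        intro y hy
        rw [← Real.sqrt_inv]
        apply Real.sqrt_le_sqrt
        rw [inv_le_comm₀ (by linarith) (by norm_num)]; linarith
      have n1 : 0 ≤ (√x)⁻¹ := by positivity
      have n2 : 0 ≤ (√(1-x))⁻¹ := by positivity
      have n3 : 0 ≤ √(2:ℝ) := by positivity
      rcases le_total (1/2) x with h | h
      · have := key x h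
        nlinarith [mul_le_mul_of_nonneg_right this n2, mul_nonneg n3 n1]
      · have := key (1 - x) (by linarith)
        nlinarith [mul_le_mul_of_nonneg_left this n1, mul_nonneg n3 n2]
    · rw [indicator_of_notMem hx]
      simp only [mem_Ioc, not_and_or, not_lt, not_le] at hx
      rcases hx with hx | hx
      · rw [Real.sqrt_eq_zero_of_nonpos hx]; simp
      · rw [Real.sqrt_eq_zero_of_nonpos (by linarith : 1 - x ≤ 0)]; simp

theorem phiK_pos : 0 < ∫ x, phiK x := by
  rw [integral_pos_iff_support_of_nonneg phiK_nonneg phiK_int]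
  have : Ioo (0:ℝ) 1 ⊆ Function.support phiK := by
    intro x hx
    have h1 := Real.sqrt_pos.2 hx.1
    have h2 := Real.sqrt_pos.2 (by linarith [hx.2] : 0 < 1 - x)
    simp only [Function.mem_support, phiK]; positivity
  refine lt_of_lt_of_le ?_ (measure_mono this)
  simp

theorem ker_eq {A B : ℝ} (h : A < B) :
    (fun w => (√(w - A))⁻¹ * (√(B - w))⁻¹) = fun w => (B - A)⁻¹ * phiK ((w - A) / (B - A)) := by
  funext w
  have hd : 0 < B - A := by linarith
  have hd2 : B - A ≠ 0 := hd.ne'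
  unfold phiK
  have e : 1 - (w - A) / (B - A) = (B - w) / (B - A) := by field_simp; ring
  rw [e, Real.sqrt_div' _ hd.le, Real.sqrt_div' _ hd.le, inv_div, inv_div]
  have hs : √(B - A) * √(B - A) = B - A := Real.mul_self_sqrt hd.le
  calc _ = (B - A)⁻¹ * (B - A) * ((√(w - A))⁻¹ * (√(B - w))⁻¹) := by rw [inv_mul_cancel₀ hd2, one_mul]
    _ = (B - A)⁻¹ * (√(B - A) * √(B - A)) * ((√(w - A))⁻¹ * (√(B - w))⁻¹) := by rw [hs]
    _ = _ := by ring

theorem ker_zero {A B : ℝ} (h : B ≤ A) : (fun w => (√(w - A))⁻¹ * (√(B - w))⁻¹) = fun _ => 0 := by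
  funext w
  rcases le_total w A with hw | hw
  · rw [Real.sqrt_eq_zero_of_nonpos (by linarith : w - A ≤ 0)]; simp
  · rw [Real.sqrt_eq_zero_of_nonpos (by linarith : B - w ≤ 0)]; simp

theorem ker_int (A B : ℝ) : Integrable (fun w => (√(w - A))⁻¹ * (√(B - w))⁻¹) := by
  rcases lt_or_ge A B with h | h
  · rw [ker_eq h]
    exact ((phiK_int.comp_div (sub_ne_zero.2 h.ne')).comp_sub_right A).const_mul _
  · rw [ker_zero h]; exact integrable_zero _ _ _

theorem ker_val (A B : ℝ) : ∫ w, (√(w - A))⁻¹ * (√(B - w))⁻¹ = if A < B then ∫ x, phiK x else 0 := by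
  split_ifs with h
  · rw [ker_eq h, integral_const_mul, integral_sub_right_eq_self (fun w => phiK (w / (B - A))) A,
      Measure.integral_comp_div, abs_of_pos (by linarith), smul_eq_mul, ← mul_assoc,
      inv_mul_cancel₀ (sub_ne_zero.2 h.ne'), one_mul]
  · rw [ker_zero (not_lt.1 h)]; simp

theorem abel_inj {q h : ℝ → ℝ} {a κ : ℝ} (hκ : 0 < κ) (hqc : Continuous q)
    (hh : Continuous h)
    (hq : ∀ s t, a ≤ s → s ≤ t → t ≤ 1 → κ * (t - s) ≤ q t - q s)
    (hf : ∀ r ∈ Ioo a 1, (∫ s in a..1, h s * (√(q s - q r))⁻¹) = 0) :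
    ∀ r ∈ Ioo a 1, h r = 0 := by
  have hlt : ∀ s t, a ≤ s → s < t → t ≤ 1 → q s < q t := fun s t h1 h2 h3 => by
    have := hq s t h1 h2.le h3
    have : 0 < κ * (t - s) := mul_pos hκ (by linarith)
    linarith
  have hle : ∀ s t, a ≤ s → s ≤ t → t ≤ 1 → q s ≤ q t := fun s t h1 h2 h3 => by
    have := hq s t h1 h2 h3
    have : 0 ≤ κ * (t - s) := mul_nonneg hκ.le (by linarith)
    linarith
  have main : ∀ r ∈ Ioo a 1, ∫ s in r..1, h s = 0 := by
    intro r hr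
    have ha1 : a ≤ 1 := (hr.1.trans hr.2).le
    set Φ : ℝ → ℝ → ℝ := fun w s => (√(w - q r))⁻¹ * (h s * (√(q s - w))⁻¹) with hΦ
    have hΦ2 : ∀ w s, Φ w s = h s * ((√(w - q r))⁻¹ * (√(q s - w))⁻¹) := fun w s => by simp only [hΦ]; ring
    have hmeas : Measurable (Function.uncurry Φ) := by
      have := hqc.measurable; have := hh.measurable
      simp only [hΦ, Function.uncurry_def]
      fun_prop
    have hintg : Integrable (Function.uncurry Φ) (volume.prod (volume.restrict (Ioc a 1))) := by
      rw [integrable_prod_iff' hmeas.aestronglyMeasurable]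
      constructor
      · refine Filter.Eventually.of_forall fun s => ?_
        simp only [Function.uncurry_apply_pair, hΦ2]
        exact (ker_int _ _).const_mul _
      · simp only [Function.uncurry_apply_pair, hΦ2]
        have e : (fun s => ∫ w, ‖h s * ((√(w - q r))⁻¹ * (√(q s - w))⁻¹)‖) =
            fun s => |h s| * (if q r < q s then ∫ x, phiK x else 0) := by
          funext s
          have : ∀ w, ‖h s * ((√(w - q r))⁻¹ * (√(q s - w))⁻¹)‖ = |h s| * ((√(w - q r))⁻¹ * (√(q s - w))⁻¹) := by
            intro w
            rw [norm_mul, Real.norm_eq_abs, Real.norm_of_nonneg (by positivity)]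
          simp only [this]
          rw [integral_const_mul, ker_val]
        rw [e]
        have hi : IntegrableOn (fun s => |h s| * ∫ x, phiK x) (Ioc a 1) :=
          ((hh.abs.mul continuous_const).intervalIntegrable a 1).1
        refine hi.mono' ?_ ?_
        · refine Measurable.aestronglyMeasurable ?_
          refine hh.abs.measurable.mul ?_
          exact Measurable.ite (measurableSet_lt measurable_const hqc.measurable) measurable_const measurable_const
        · refine Filter.Eventually.of_forall fun s => ?_
          rw [norm_mul, Real.norm_eq_abs, abs_abs]
          have := phiK_pos.le
          gcongr
          split_ifs
          · rw [Real.norm_of_nonneg this]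
          · simpa using this
    have hswap := integral_integral_swap hintg
    have hleft : ∀ w, ∫ s in Ioc a 1, Φ w s = 0 := by
      intro w
      simp only [hΦ]
      rw [integral_const_mul]
      rcases le_or_gt w (q r) with hw | hw
      · rw [Real.sqrt_eq_zero_of_nonpos (by linarith : w - q r ≤ 0)]; simp
      rcases le_or_gt (q 1) w with hw1 | hw1
      · have : ∀ s ∈ Ioc a 1, h s * (√(q s - w))⁻¹ = 0 := by
          intro s hs
          have := hle s 1 hs.1.le hs.2 le_rfl
          rw [Real.sqrt_eq_zero_of_nonpos (by linarith : q s - w ≤ 0)]; simp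
        rw [setIntegral_congr_fun measurableSet_Ioc this]; simp
      · obtain ⟨t, ht, rfl⟩ := intermediate_value_Ioo hr.2.le hqc.continuousOn ⟨hw, hw1⟩
        have := hf t ⟨hr.1.trans ht.1, ht.2⟩
        rw [intervalIntegral.integral_of_le ha1] at this
        rw [this, mul_zero]
    simp only [hleft, integral_zero] at hswap
    simp only [hΦ2, integral_const_mul, ker_val] at hswap
    have e : ∀ s ∈ Ioc a 1, h s * (if q r < q s then ∫ x, phiK x else 0) =
        (Ioc r 1).indicator (fun s => h s * ∫ x, phiK x) s := by
      intro s hs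
      by_cases hrs : r < s
      · rw [if_pos (hlt r s hr.1.le hrs hs.2), indicator_of_mem (show s ∈ Ioc r 1 from ⟨hrs, hs.2⟩)]
      · push Not at hrs
        rw [if_neg (not_lt.2 (hle s r hs.1.le hrs hr.2.le)), indicator_of_notMem (by intro h; linarith [h.1]), mul_zero]
    rw [setIntegral_congr_fun measurableSet_Ioc e, setIntegral_indicator measurableSet_Ioc,
      inter_eq_self_of_subset_right (Ioc_subset_Ioc_left hr.1.le), integral_mul_const] at hswap
    rw [intervalIntegral.integral_of_le hr.2.le]
    exact (mul_eq_zero.1 hswap.symm).resolve_right phiK_pos.ne'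
  intro r hr
  have hd : HasDerivAt (fun u => ∫ s in u..1, h s) (-h r) r :=
    intervalIntegral.integral_hasDerivAt_left (hh.intervalIntegrable _ _)
      (hh.stronglyMeasurableAtFilter _ _) hh.continuousAt
  have hz : HasDerivAt (fun u => ∫ s in u..1, h s) 0 r := by
    refine (hasDerivAt_const r (0:ℝ)).congr_of_eventuallyEq ?_
    filter_upwards [isOpen_Ioo.mem_nhds hr] with u hu using main u hu
  have := hd.unique hz
  linarith

noncomputable def cl (a s : ℝ) : ℝ := max a (min s 1)

theorem cl_cont (a : ℝ) : Continuous (cl a) := by unfold cl; fun_prop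
theorem cl_mem {a : ℝ} (ha : a ≤ 1) (s : ℝ) : cl a s ∈ Icc a 1 :=
  ⟨le_max_left _ _, max_le ha (min_le_right _ _)⟩
theorem cl_eq {a s : ℝ} (hs : s ∈ Icc a 1) : cl a s = s := by
  unfold cl; rw [min_eq_left hs.2, max_eq_right hs.1]

noncomputable def prof (c : ℝ → ℝ) (a s : ℝ) : ℝ := cl a s / c (cl a s)

theorem prof_cont {c : ℝ → ℝ} {a : ℝ} (ha : a ≤ 1) (hpos : ∀ r ∈ Icc a 1, 0 < c r)
    (hc : ContinuousOn c (Icc a 1)) : Continuous (prof c a) := by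
  have h1 : Continuous (fun s => c (cl a s)) := hc.comp_continuous (cl_cont a) (cl_mem ha)
  exact (cl_cont a).div h1 fun s => (hpos _ (cl_mem ha s)).ne'

/-- quantitative growth from the Herglotz condition -/
theorem herg_growth {c : ℝ → ℝ} {R : ℝ} (hR : R < 1) (hpos : ∀ r ∈ Icc R 1, 0 < c r)
    (hC : IsC11On c R) (hH : HerglotzCond c R) :
    ∃ κ > 0, ∀ s t, R ≤ s → s ≤ t → t ≤ 1 → κ * (t - s) ≤ t / c t - s / c s := by
  obtain ⟨c', K, hd, hl⟩ := hC
  have hcc : ContinuousOn c (Icc R 1) := fun r hr => (hd r hr).continuousWithinAt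
  have hder : ∀ r ∈ Icc R 1, HasDerivWithinAt (fun s => s / c s) ((1 * c r - r * c' r) / c r ^ 2) (Icc R 1) r :=
    fun r hr => (hasDerivWithinAt_id r _).div (hd r hr) (hpos r hr).ne'
  have hp : ∀ r ∈ Icc R 1, 0 < (1 * c r - r * c' r) / c r ^ 2 := by
    intro r hr
    have := hH r hr
    rwa [(hder r hr).derivWithin (uniqueDiffOn_Icc hR r hr)] at this
  have hcont : ContinuousOn (fun r => (1 * c r - r * c' r) / c r ^ 2) (Icc R 1) := by
    have := hl.continuousOn
    refine ContinuousOn.div (by fun_prop) (by fun_prop) fun r hr => (pow_pos (hpos r hr) 2).ne'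
  obtain ⟨r0, hr0, hmin⟩ := isCompact_Icc.exists_isMinOn (nonempty_Icc.2 hR.le) hcont
  refine ⟨_, hp r0 hr0, ?_⟩
  intro s t hs hst ht
  refine (convex_Icc R 1).mul_sub_le_image_sub_of_le_deriv (f := fun s => s / c s)
    (fun r hr => (hder r hr).continuousWithinAt) ?_ ?_ s ⟨hs, hst.trans ht⟩ t ⟨hs.trans hst, ht⟩ hst
  · intro r hr
    exact ((hder r (interior_subset hr)).mono interior_subset).differentiableWithinAt
  · intro r hr
    have h1 := (hder r (interior_subset hr)).hasDerivAt (mem_interior_iff_mem_nhds.1 hr)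
    rw [h1.deriv]
    exact hmin (interior_subset hr)

theorem prof_growth {c : ℝ → ℝ} {R a : ℝ} (hRa : R ≤ a) (ha0 : 0 < a) (ha : a < 1) (hpos : ∀ r ∈ Icc R 1, 0 < c r)
    (hC : IsC11On c R) (hH : HerglotzCond c R) :
    ∃ κ > 0, ∀ s t, a ≤ s → s ≤ t → t ≤ 1 → κ * (t - s) ≤ prof c a t ^ 2 - prof c a s ^ 2 := by
  obtain ⟨κ, hκ, h⟩ := herg_growth (hRa.trans_lt ha) hpos hC hH
  have hpa : 0 < a / c a := div_pos ha0 (hpos a ⟨hRa, ha.le⟩)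
  refine ⟨κ * (a / c a), mul_pos hκ hpa, ?_⟩
  intro s t hs hst ht
  rw [prof, prof, cl_eq ⟨hs.trans hst, ht⟩, cl_eq ⟨hs, hst.trans ht⟩]
  have h1 := h s t (hRa.trans hs) hst ht
  have h2 := h a s hRa hs (hst.trans ht)
  have h3 : 0 ≤ κ * (t - s) := mul_nonneg hκ.le (by linarith)
  have h4 : 0 ≤ κ * (s - a) := mul_nonneg hκ.le (by linarith)
  calc κ * (a / c a) * (t - s) = κ * (t - s) * (a / c a) := by ring
    _ ≤ (t / c t - s / c s) * (t / c t + s / c s) := by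
      apply mul_le_mul h1 (by linarith) hpa.le (by linarith)
    _ = _ := by ring

theorem Kq_int {q : ℝ → ℝ} {a κ : ℝ} (ha : a ≤ 1) (hκ : 0 < κ) (hqc : Continuous q)
    (hq : ∀ s t, a ≤ s → s ≤ t → t ≤ 1 → κ * (t - s) ≤ q t - q s) {r : ℝ} (hr : r ∈ Icc a 1) :
    IntervalIntegrable (fun s => (√(q s - q r))⁻¹) volume a 1 := by
  refine (Kr_int κ r a 1).mono_fun' ?_ ?_
  · refine Measurable.aestronglyMeasurable ?_
    have := hqc.measurable
    fun_prop
  · rw [uIoc_of_le ha]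
    filter_upwards [ae_restrict_mem measurableSet_Ioc, ae_restrict_of_ae (Measure.ae_ne volume r)] with s hs hsr
    rw [Real.norm_of_nonneg (by positivity)]
    rcases le_total (q s - q r) 0 with h | h
    · rw [Real.sqrt_eq_zero_of_nonpos h, inv_zero]; positivity
    · have h1 := growth_abs hq hr ⟨hs.1.le, hs.2⟩
      rw [abs_of_nonneg h] at h1
      have : 0 < √(κ * |s - r|) := Real.sqrt_pos.2 (mul_pos hκ (abs_pos.2 (sub_ne_zero.2 hsr)))
      gcongr

theorem int_restrict {φ ψ : ℝ → ℝ} {a r : ℝ} (har : a ≤ r) (hr : r ≤ 1) (h0 : ∀ s, a < s → s ≤ r → φ s = 0)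
    (h1 : ∀ s, r < s → s ≤ 1 → φ s = ψ s) : ∫ s in a..1, φ s = ∫ s in r..1, ψ s := by
  rw [intervalIntegral.integral_of_le (har.trans hr), intervalIntegral.integral_of_le hr]
  rw [← setIntegral_congr_fun measurableSet_Ioc (fun s hs => h1 s hs.1 hs.2)]
  refine setIntegral_eq_of_subset_of_forall_sdiff_eq_zero measurableSet_Ioc (Ioc_subset_Ioc_left har) ?_
  intro s hs
  have : ¬ (r < s) := fun h => hs.2 ⟨h, hs.1.2⟩
  exact h0 s hs.1.1 (not_lt.1 this)

noncomputable def Fz (p : ℝ → ℝ) (a z : ℝ) : ℝ := ∫ s in a..1, (cl a s)⁻¹ * √(p s ^ 2 - z ^ 2)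

section single
variable {c : ℝ → ℝ} {R a : ℝ}

theorem C11_cont {a : ℝ} (hC : IsC11On c R) (hRa : R ≤ a) : ContinuousOn c (Icc a 1) := by
  obtain ⟨c', K, hd, hl⟩ := hC
  exact fun r hr => ((hd r ⟨hRa.trans hr.1, hr.2⟩).continuousWithinAt).mono (Icc_subset_Icc_left hRa)

theorem prof_pos (ha0 : 0 < a) (ha : a < 1) (hpos : ∀ r ∈ Icc a 1, 0 < c r) (s : ℝ) : 0 < prof c a s := 
  div_pos (ha0.trans_le (cl_mem ha.le s).1) (hpos _ (cl_mem ha.le s))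

theorem int_core {ρs ρr : ℝ} (h : 0 < ρr) (h2 : ρr < ρs) :
    (√(1 - (ρr / ρs) ^ 2))⁻¹ = ρs * (√(ρs ^ 2 - ρr ^ 2))⁻¹ := by
  have hs : 0 < ρs := h.trans h2
  have e : 1 - (ρr / ρs) ^ 2 = (ρs ^ 2 - ρr ^ 2) / ρs ^ 2 := by field_simp
  rw [e, Real.sqrt_div' _ (sq_nonneg _), Real.sqrt_sq hs.le, inv_div, div_eq_mul_inv]

theorem prof_lt (hRa : R ≤ a) (ha0 : 0 < a) (ha : a < 1) (hpos : ∀ r ∈ Icc R 1, 0 < c r)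
    (hC : IsC11On c R) (hH : HerglotzCond c R) {s t : ℝ} (hs : a ≤ s) (hst : s < t) (ht : t ≤ 1) :
    prof c a s < prof c a t := by
  obtain ⟨κ, hκ, hg⟩ := prof_growth hRa ha0 ha hpos hC hH
  have hp := prof_pos ha0 ha (fun r hr => hpos r ⟨hRa.trans hr.1, hr.2⟩)
  have h1 := hg s t hs hst.le ht
  have h2 : 0 < κ * (t - s) := mul_pos hκ (by linarith)
  exact lt_of_pow_lt_pow_left₀ 2 (hp t).le (by linarith)

theorem alpha_eq (hRa : R ≤ a) (ha0 : 0 < a) (ha : a < 1) (hpos : ∀ r ∈ Icc R 1, 0 < c r)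
    (hC : IsC11On c R) (hH : HerglotzCond c R) {r : ℝ} (hr : r ∈ Ioo a 1) :
    alphaFun c r = ∫ s in a..1, (cl a s)⁻¹ * (prof c a r * (√(prof c a s ^ 2 - prof c a r ^ 2))⁻¹) := by
  have hp := prof_pos ha0 ha (fun r hr => hpos r ⟨hRa.trans hr.1, hr.2⟩)
  symm
  refine int_restrict hr.1.le hr.2.le ?_ ?_
  · intro s hs hsr
    have : prof c a s ≤ prof c a r := by
      rcases hsr.eq_or_lt with rfl | h
      · exact le_rfl
      · exact (prof_lt hRa ha0 ha hpos hC hH hs.le h hr.2.le).le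
    have h2 : prof c a s ^ 2 - prof c a r ^ 2 ≤ 0 := by nlinarith [hp s, hp r]
    rw [Real.sqrt_eq_zero_of_nonpos h2]; simp
  · intro s hrs hs
    have hlt := prof_lt hRa ha0 ha hpos hC hH hr.1.le hrs hs
    have e1 : r * c s / (s * c r) = prof c a r / prof c a s := by
      rw [prof, prof, cl_eq (Ioo_subset_Icc_self hr), cl_eq ⟨hr.1.le.trans hrs.le, hs⟩]
      rw [div_div_div_eq, mul_comm s]
    rw [e1, int_core (hp r) hlt]
    rw [← mul_assoc, ← mul_assoc]
    congr 1
    rw [prof, prof, cl_eq (Ioo_subset_Icc_self hr), cl_eq ⟨hr.1.le.trans hrs.le, hs⟩]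
    have h1 : 0 < s := by linarith [hr.1]
    have h2 := (hpos s ⟨by linarith [hr.1], hs⟩).ne'
    have h3 := (hpos r ⟨by linarith [hr.1], hr.2.le⟩).ne'
    field_simp

theorem L_eq (hRa : R ≤ a) (ha0 : 0 < a) (ha : a < 1) (hpos : ∀ r ∈ Icc R 1, 0 < c r)
    (hC : IsC11On c R) (hH : HerglotzCond c R) {r : ℝ} (hr : r ∈ Ioo a 1) :
    Lfun c r = Fz (prof c a) a (prof c a r) + prof c a r * alphaFun c r := by
  have hposa : ∀ r ∈ Icc a 1, 0 < c r := fun r hr => hpos r ⟨hRa.trans hr.1, hr.2⟩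
  have hp := prof_pos ha0 ha hposa
  have hpc := prof_cont ha.le hposa (C11_cont hC hRa)
  obtain ⟨κ, hκ, hg⟩ := prof_growth hRa ha0 ha hpos hC hH
  have hclinv : Continuous (fun s => (cl a s)⁻¹) := (cl_cont a).inv₀ fun s => (ha0.trans_le (cl_mem ha.le s).1).ne'
  rw [alpha_eq hRa ha0 ha hpos hC hH hr, Fz, ← intervalIntegral.integral_const_mul,
    ← intervalIntegral.integral_add]
  · symm
    refine int_restrict hr.1.le hr.2.le ?_ ?_
    · intro s hs hsr
      have : prof c a s ≤ prof c a r := by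
        rcases hsr.eq_or_lt with rfl | h
        · exact le_rfl
        · exact (prof_lt hRa ha0 ha hpos hC hH hs.le h hr.2.le).le
      have h2 : prof c a s ^ 2 - prof c a r ^ 2 ≤ 0 := by nlinarith [hp s, hp r]
      rw [Real.sqrt_eq_zero_of_nonpos h2]; simp
    · intro s hrs hs
      have hlt := prof_lt hRa ha0 ha hpos hC hH hr.1.le hrs hs
      have e1 : r * c s / (s * c r) = prof c a r / prof c a s := by
        rw [prof, prof, cl_eq (Ioo_subset_Icc_self hr), cl_eq ⟨hr.1.le.trans hrs.le, hs⟩]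
        rw [div_div_div_eq, mul_comm s]
      rw [e1, int_core (hp r) hlt]
      have e2 : (c s)⁻¹ = (cl a s)⁻¹ * prof c a s := by
        rw [prof, cl_eq ⟨hr.1.le.trans hrs.le, hs⟩]
        have h1 : 0 < s := by linarith [hr.1]
        field_simp
      rw [e2]
      have hx : 0 < prof c a s ^ 2 - prof c a r ^ 2 := by nlinarith [hp s, hp r]
      have hsx := Real.sqrt_pos.2 hx
      have hsq := Real.sq_sqrt hx.le
      set X := √(prof c a s ^ 2 - prof c a r ^ 2)
      have e3 : X + prof c a r ^ 2 * X⁻¹ = prof c a s ^ 2 * X⁻¹ := by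
        field_simp; linarith
      calc _ = (cl a s)⁻¹ * (X + prof c a r ^ 2 * X⁻¹) := by ring
        _ = _ := by rw [e3]; ring
  · exact Continuous.intervalIntegrable (by fun_prop) _ _
  · have := Kq_int (q := fun s => prof c a s ^ 2) ha.le hκ (hpc.pow 2) hg (Ioo_subset_Icc_self hr)
    have := this.continuousOn_mul (g := fun s => prof c a r * ((cl a s)⁻¹ * prof c a r))
      (continuous_const.mul (hclinv.mul continuous_const)).continuousOn
    refine this.congr ?_
    intro s _
    simp only; ring

theorem Fz_deriv (hRa : R ≤ a) (ha0 : 0 < a) (ha : a < 1) (hpos : ∀ r ∈ Icc R 1, 0 < c r)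
    (hC : IsC11On c R) (hH : HerglotzCond c R) {r : ℝ} (hr : r ∈ Ioo a 1) :
    HasDerivAt (Fz (prof c a) a) (- alphaFun c r) (prof c a r) := by
  have hposa : ∀ r ∈ Icc a 1, 0 < c r := fun r hr => hpos r ⟨hRa.trans hr.1, hr.2⟩
  have hpc := prof_cont ha.le hposa (C11_cont hC hRa)
  obtain ⟨κ, hκ, hg⟩ := prof_growth hRa ha0 ha hpos hC hH
  have hclinv : Continuous (fun s => (cl a s)⁻¹) := (cl_cont a).inv₀ fun s => (ha0.trans_le (cl_mem ha.le s).1).ne'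
  have := deriv_sqrt_int (q := fun s => prof c a s ^ 2) ha hκ (hpc.pow 2) hg (Ioo_subset_Icc_self hr)
    (g := fun s => (cl a s)⁻¹) hclinv (B := fun z s => prof c a s ^ 2 - z ^ 2)
    (B' := fun s => - (2 * prof c a r)) (t0 := prof c a r) (C := 2 * |prof c a r| + 1) (δ := 1) one_pos
    (fun t => by fun_prop) (by fun_prop) (fun s => rfl)
    (by
      intro t ht s _
      have h1 : |t - prof c a r| < 1 := ht
      have : prof c a s ^ 2 - t ^ 2 - (prof c a s ^ 2 - prof c a r ^ 2) = - ((t - prof c a r) * ((t - prof c a r) + 2 * prof c a r)) := by ring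
      rw [this, abs_neg, abs_mul, mul_comm]
      gcongr
      refine (abs_add_le _ _).trans ?_
      rw [abs_mul, abs_two]; linarith)
    (by
      intro s _
      have := ((hasDerivAt_pow 2 (prof c a r)).const_sub (prof c a s ^ 2))
      simpa using this)
  rw [alpha_eq hRa ha0 ha hpos hC hH hr, ← intervalIntegral.integral_neg]
  unfold Fz
  convert this using 1
  congr 1
  funext s
  ring

theorem alpha_nonneg {r : ℝ} (hr : 0 ≤ r) (hr1 : r ≤ 1) (hpos : ∀ s ∈ Icc r 1, 0 < c s) : 0 ≤ alphaFun c r := by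
  unfold alphaFun
  refine intervalIntegral.integral_nonneg hr1 fun s hs => ?_
  have := hpos s hs
  have := hpos r ⟨le_rfl, hr1⟩
  positivity
end single

theorem level_countable {f : ℝ → ℝ} {U : Set ℝ} (h : {r | r ∈ U ∧ deriv f r = 0}.Countable) (v : ℝ) :
    {r | r ∈ U ∧ f r = v}.Countable := by
  set E : Set ℝ := {r | f r = v ∧ deriv f r ≠ 0} with hE
  have hEc : E.Countable := by
    have : DiscreteTopology E := by
      rw [discreteTopology_subtype_iff]
      rintro x ⟨hx, hd⟩
      have h1 : ∀ᶠ y in 𝓝[≠] x, f y ≠ v := 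
        (differentiableAt_of_deriv_ne_zero hd).hasDerivAt.eventually_ne hd
      rw [Filter.inf_principal_eq_bot]
      filter_upwards [h1] with y hy hyE
      exact hy hyE.1
    have : Countable E := countable_of_Lindelof_of_discrete
    exact Set.countable_coe_iff.1 this
  refine (h.union hEc).mono ?_
  rintro r ⟨hr, hv⟩
  by_cases hd : deriv f r = 0
  · exact Or.inl ⟨hr, hd⟩
  · exact Or.inr ⟨hv, hd⟩

theorem lsp_countable {c : ℝ → ℝ} {R : ℝ}
    (h : {r | r ∈ Ioo R 1 ∧ deriv (alphaFun c) r = 0}.Countable) : (lsp c R).Countable := by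
  have : lsp c R ⊆ ⋃ n : ℕ, ⋃ m : ℕ, (fun r => 2 * (n : ℝ) * Lfun c r) ''
      {r | r ∈ Ioo R 1 ∧ alphaFun c r = (m : ℝ) * Real.pi / n} := by
    rintro _ ⟨r, hr, n, m, hn, hm, -, h1, rfl⟩
    refine mem_iUnion.2 ⟨n, mem_iUnion.2 ⟨m, r, ⟨hr, ?_⟩, rfl⟩⟩
    have : (n : ℝ) ≠ 0 := by positivity
    rw [eq_div_iff this, mul_comm, h1]
  refine (countable_iUnion fun n => countable_iUnion fun m => ?_).mono this
  exact (level_countable h _).image _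

theorem lsp'_countable {c : ℝ → ℝ} {R : ℝ} (hR : R ∈ Ioo (0:ℝ) 1) (hpos : ∀ r ∈ Icc R 1, 0 < c r)
    (hC : IsC11On c R) (hH : HerglotzCond c R)
    (h : {r | r ∈ Ioo R 1 ∧ deriv (alphaFun c) r = 0}.Countable) : (lsp' c R).Countable := by
  refine (lsp_countable h).union ?_
  have hcc := C11_cont hC le_rfl
  obtain ⟨κ, hκ, hg⟩ := herg_growth hR.2 hpos hC hH
  have hlt1 : ∀ z, 0 < z → z < R / c R → ∀ r ∈ Icc R 1, 0 < z * c r / r ∧ z * c r / r < 1 := by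
    intro z hz hz1 r hr
    have h1 := hg R r le_rfl hr.1 hr.2
    have h2 : 0 ≤ κ * (r - R) := mul_nonneg hκ.le (by linarith [hr.1])
    have h3 := hpos r hr
    have h4 : 0 < r := hR.1.trans_le hr.1
    have h5 : z < r / c r := by linarith
    rw [lt_div_iff₀ h3] at h5
    exact ⟨by positivity, by rwa [div_lt_one h4]⟩
  have hinj : ∀ z1 z2, 0 < z1 → z1 < z2 → z2 < R / c R → betaFun c R z1 < betaFun c R z2 := by
    intro z1 z2 hz1 h12 hz2
    have hcon : ∀ z, 0 < z → z < R / c R →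
        ContinuousOn (fun r => (z * c r / r ^ 2) * (√(1 - (z * c r / r) ^ 2))⁻¹) (Icc R 1) := by
      intro z hz hz1
      refine ContinuousOn.mul ?_ (ContinuousOn.inv₀ ?_ ?_)
      · exact ContinuousOn.div (by fun_prop) (by fun_prop) fun r hr => (pow_pos (hR.1.trans_le hr.1) 2).ne'
      · refine ContinuousOn.sqrt (continuousOn_const.sub (ContinuousOn.pow ?_ 2))
        exact ContinuousOn.div (by fun_prop) (by fun_prop) fun r hr => (hR.1.trans_le hr.1).ne'
      · intro r hr
        obtain ⟨h1, h2⟩ := hlt1 z hz hz1 r hr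
        exact (Real.sqrt_pos.2 (by nlinarith)).ne'
    have hstrict : ∀ r ∈ Icc R 1, (z1 * c r / r ^ 2) * (√(1 - (z1 * c r / r) ^ 2))⁻¹ <
        (z2 * c r / r ^ 2) * (√(1 - (z2 * c r / r) ^ 2))⁻¹ := by
      intro r hr
      have h3 := hpos r hr
      have h4 : 0 < r := hR.1.trans_le hr.1
      obtain ⟨a1, a2⟩ := hlt1 z1 hz1 (h12.trans hz2) r hr
      obtain ⟨b1, b2⟩ := hlt1 z2 (hz1.trans h12) hz2 r hr
      have hle : z1 * c r / r ≤ z2 * c r / r := by gcongr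
      have s2 : 0 < √(1 - (z2 * c r / r) ^ 2) := Real.sqrt_pos.2 (by nlinarith)
      have s1 : 0 < √(1 - (z1 * c r / r) ^ 2) := Real.sqrt_pos.2 (by nlinarith)
      have hs : √(1 - (z2 * c r / r) ^ 2) ≤ √(1 - (z1 * c r / r) ^ 2) := by
        apply Real.sqrt_le_sqrt; gcongr
      have hi : (√(1 - (z1 * c r / r) ^ 2))⁻¹ ≤ (√(1 - (z2 * c r / r) ^ 2))⁻¹ := by gcongr
      have hl : z1 * c r / r ^ 2 < z2 * c r / r ^ 2 := by gcongr
      have hz2p : 0 < z2 := hz1.trans h12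
      exact mul_lt_mul hl hi (by positivity) (by positivity)
    unfold betaFun
    refine intervalIntegral.integral_lt_integral_of_continuousOn_of_le_of_exists_lt hR.2
      (hcon z1 hz1 (h12.trans hz2)) (hcon z2 (hz1.trans h12) hz2)
      (fun r hr => (hstrict r (Ioc_subset_Icc_self hr)).le) ⟨1, ⟨hR.2.le, le_rfl⟩, hstrict 1 ⟨hR.2.le, le_rfl⟩⟩
  have : {ℓ | ∃ z : ℝ, 0 < z ∧ z < R / c R ∧ ∃ n m : ℕ, 0 < n ∧ 0 < m ∧ Nat.Coprime n m ∧
      (n : ℝ) * betaFun c R z = (m : ℝ) * Real.pi ∧ ℓ = 2 * (n : ℝ) * Tfun c R z} ⊆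
      ⋃ n : ℕ, ⋃ m : ℕ, (fun z => 2 * (n : ℝ) * Tfun c R z) ''
      {z | z ∈ Ioo 0 (R / c R) ∧ betaFun c R z = (m : ℝ) * Real.pi / n} := by
    rintro _ ⟨z, hz0, hz, n, m, hn, hm, -, h1, rfl⟩
    refine mem_iUnion.2 ⟨n, mem_iUnion.2 ⟨m, z, ⟨⟨hz0, hz⟩, ?_⟩, rfl⟩⟩
    have : (n : ℝ) ≠ 0 := by positivity
    rw [eq_div_iff this, mul_comm, h1]
  refine (countable_iUnion fun n => countable_iUnion fun m => ?_).mono this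
  refine (Set.Subsingleton.countable ?_).image _
  rintro x ⟨hx, hx1⟩ y ⟨hy, hy1⟩
  rcases lt_trichotomy x y with hxy | hxy | hxy
  · have := hinj x y hx.1 hxy hy.2; linarith
  · exact hxy
  · have := hinj y x hy.1 hxy hx.2; linarith

/-- critical values are lengths -/
theorem crit_mem_lsp {c : ℝ → ℝ} {R a : ℝ} (hRa : R ≤ a) (ha0 : 0 < a) (ha : a < 1)
    (hpos : ∀ r ∈ Icc R 1, 0 < c r) (hC : IsC11On c R) (hH : HerglotzCond c R)
    {σ : ℝ} (hσ : σ ≠ 0) {x : ℚ} (hx : 0 < x) {z : ℝ} (hz1 : prof c a a < z) (hz2 : z < prof c a 1)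
    (hmin : IsLocalMin (fun z => σ * (Fz (prof c a) a z + (x * Real.pi) * z)) z) :
    2 * (x.den : ℝ) * (Fz (prof c a) a z + (x * Real.pi) * z) ∈ lsp c R := by
  have hposa : ∀ r ∈ Icc a 1, 0 < c r := fun r hr => hpos r ⟨hRa.trans hr.1, hr.2⟩
  have hpc := prof_cont ha.le hposa (C11_cont hC hRa)
  obtain ⟨r, hr, rfl⟩ := intermediate_value_Ioo ha.le hpc.continuousOn ⟨hz1, hz2⟩
  have hd := ((Fz_deriv hRa ha0 ha hpos hC hH hr).add ((hasDerivAt_id _).const_mul (x * Real.pi))).const_mul σ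
  have h0 := hmin.hasDerivAt_eq_zero hd
  have hal : alphaFun c r = x * Real.pi := by
    have := (mul_eq_zero.1 h0).resolve_left hσ
    linarith
  have hnum : ((x.num.natAbs : ℕ) : ℝ) = (x.num : ℝ) := by
    have h1 : ((x.num.natAbs : ℕ) : ℤ) = x.num := Int.natAbs_of_nonneg (Rat.num_pos.2 hx).le
    rw [← Int.cast_natCast, h1]
  have hden : (x.den : ℝ) ≠ 0 := by exact_mod_cast x.den_nz
  refine ⟨r, ⟨hRa.trans_lt hr.1, hr.2⟩, x.den, x.num.natAbs, x.den_pos,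
    Int.natAbs_pos.2 (Rat.num_pos.2 hx).ne', x.reduced.symm, ?_, ?_⟩
  · rw [hal, hnum]
    have : (x : ℝ) = x.num / x.den := by exact_mod_cast (Rat.num_div_den x).symm
    rw [this]; field_simp
  · rw [L_eq hRa ha0 ha hpos hC hH hr, hal]; ring

theorem const_deriv {f : ℝ → ℝ} {U : Set ℝ} (hU : IsOpen U) (hf : ∀ x ∈ U, ∀ y ∈ U, f x = f y) :
    ∀ x ∈ U, deriv f x = 0 := by
  intro x hx
  have : f =ᶠ[𝓝 x] fun _ => f x := by
    filter_upwards [hU.mem_nhds hx] with y hy using hf y hy x hx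
  rw [this.deriv_eq, deriv_const]

theorem core {R ε : ℝ} (hR : R ∈ Ico (0:ℝ) 1) {c cdot : ℝ → ℝ → ℝ} {S : Set ℝ} (hS : S.Countable)
    (hpos : ∀ τ ∈ Ioo (-ε) ε, ∀ r ∈ Icc R 1, 0 < c τ r)
    (hC11 : ∀ τ ∈ Ioo (-ε) ε, IsC11On (c τ) R)
    (hHerg : ∀ τ ∈ Ioo (-ε) ε, HerglotzCond (c τ) R)
    (hccc : ∀ τ ∈ Ioo (-ε) ε, {r | r ∈ Ioo R 1 ∧ deriv (alphaFun (c τ)) r = 0}.Countable)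
    (hcont : ContinuousOn (fun p : ℝ × ℝ => c p.1 p.2) (Ioo (-ε) ε ×ˢ Icc R 1))
    (hdtau : ∀ τ ∈ Ioo (-ε) ε, ∀ r ∈ Icc R 1, HasDerivWithinAt (fun t => c t r) (cdot τ r) (Ioo (-ε) ε) τ)
    (hdcont : ContinuousOn (fun p : ℝ × ℝ => cdot p.1 p.2) (Ioo (-ε) ε ×ˢ Icc R 1))
    (hlsp : ∀ τ ∈ Ioo (-ε) ε, lsp (c τ) R ⊆ S) :
    ∀ τ ∈ Ioo (-ε) ε, ∀ s ∈ Ioo R 1, cdot τ s = 0 := by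
  intro τ0 hτ0 s0 hs0
  set a := (R + s0) / 2 with hadef
  have hRa : R < a := by rw [hadef]; linarith [hs0.1]
  have has0 : a < s0 := by rw [hadef]; linarith [hs0.1]
  have ha0 : 0 < a := hR.1.trans_lt hRa
  have ha : a < 1 := has0.trans hs0.2
  have hsubR : ∀ r ∈ Icc a 1, r ∈ Icc R 1 := fun r hr => ⟨hRa.le.trans hr.1, hr.2⟩
  obtain ⟨δ, hδ, hδsub⟩ : ∃ δ > 0, Icc (τ0 - δ) (τ0 + δ) ⊆ Ioo (-ε) ε := by
    refine ⟨min (τ0 + ε) (ε - τ0) / 2, ?_, ?_⟩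
    · have : 0 < min (τ0 + ε) (ε - τ0) := lt_min (by linarith [hτ0.1]) (by linarith [hτ0.2])
      linarith
    · intro t ht
      have : 0 < min (τ0 + ε) (ε - τ0) := lt_min (by linarith [hτ0.1]) (by linarith [hτ0.2])
      have h1 := min_le_left (τ0 + ε) (ε - τ0)
      have h2 := min_le_right (τ0 + ε) (ε - τ0)
      exact ⟨by linarith [ht.1], by linarith [ht.2]⟩
  set ct : ℝ → ℝ := fun τ => max (τ0 - δ) (min τ (τ0 + δ)) with hct
  have hctc : Continuous ct := by fun_prop
  have hctm : ∀ τ, ct τ ∈ Icc (τ0 - δ) (τ0 + δ) := fun τ => ⟨le_max_left _ _, max_le (by linarith) (min_le_right _ _)⟩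
  have hcte : ∀ τ ∈ Icc (τ0 - δ) (τ0 + δ), ct τ = τ := fun τ hτ => by
    simp only [hct]; rw [min_eq_left hτ.2, max_eq_right hτ.1]
  have hct0 : ct τ0 = τ0 := hcte τ0 ⟨by linarith, by linarith⟩
  set p : ℝ → ℝ → ℝ := fun τ => prof (c (ct τ)) a with hp
  have hctI : ∀ τ, ct τ ∈ Ioo (-ε) ε := fun τ => hδsub (hctm τ)
  have hmap : ∀ x : ℝ × ℝ, (ct x.1, cl a x.2) ∈ Ioo (-ε) ε ×ˢ Icc R 1 := fun x => ⟨hctI _, hsubR _ (cl_mem ha.le _)⟩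
  have hclc := cl_cont a
  have hcc : Continuous (fun x : ℝ × ℝ => c (ct x.1) (cl a x.2)) := 
    hcont.comp_continuous (f := fun x : ℝ × ℝ => (ct x.1, cl a x.2)) (by fun_prop) hmap
  have hcdc : Continuous (fun x : ℝ × ℝ => cdot (ct x.1) (cl a x.2)) := 
    hdcont.comp_continuous (f := fun x : ℝ × ℝ => (ct x.1, cl a x.2)) (by fun_prop) hmap
  have hcpos : ∀ τ s, 0 < c (ct τ) (cl a s) := fun τ s => hpos _ (hctI τ) _ (hsubR _ (cl_mem ha.le s))
  have hclpos : ∀ s, 0 < cl a s := fun s => ha0.trans_le (cl_mem ha.le s).1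
  have hpc : Continuous (fun x : ℝ × ℝ => p x.1 x.2) := by
    simp only [hp, prof]
    exact (hclc.comp continuous_snd).div hcc fun x => (hcpos _ _).ne'
  have hp1 : ∀ τ, Continuous (p τ) := fun τ => hpc.comp (by fun_prop : Continuous fun s : ℝ => (τ, s))
  have hp2 : ∀ s, Continuous (fun τ => p τ s) := fun s => hpc.comp (by fun_prop : Continuous fun τ : ℝ => (τ, s))
  have hclinv : Continuous (fun s => (cl a s)⁻¹) := hclc.inv₀ fun s => (hclpos s).ne'
  have hFc : Continuous (fun x : ℝ × ℝ => Fz (p x.1) a x.2) := by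
    unfold Fz
    refine intervalIntegral.continuous_parametric_intervalIntegral_of_continuous' 
      (f := fun (x : ℝ × ℝ) s => (cl a s)⁻¹ * √(p x.1 s ^ 2 - x.2 ^ 2)) ?_ a 1
    have h1 : Continuous (fun y : (ℝ × ℝ) × ℝ => p y.1.1 y.2) :=
      hpc.comp (by fun_prop : Continuous fun y : (ℝ × ℝ) × ℝ => (y.1.1, y.2))
    have h2 : Continuous (fun y : (ℝ × ℝ) × ℝ => (cl a y.2)⁻¹) := hclinv.comp continuous_snd
    simp only [Function.uncurry_def]
    fun_prop
  -- the tau derivative of the squared profile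
  set qd : ℝ → ℝ → ℝ := fun τ s => 2 * p τ s * (-(cl a s * cdot (ct τ) (cl a s)) / c (ct τ) (cl a s) ^ 2) with hqd
  have hqdc : Continuous (fun x : ℝ × ℝ => qd x.1 x.2) := by
    simp only [hqd]
    refine (continuous_const.mul hpc).mul (Continuous.div ?_ (hcc.pow 2) fun x => (pow_pos (hcpos _ _) 2).ne')
    exact ((hclc.comp continuous_snd).mul hcdc).neg
  have hqder : ∀ τ ∈ Ioo (τ0 - δ) (τ0 + δ), ∀ s, HasDerivAt (fun τ => p τ s ^ 2) (qd τ s) τ := by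
    intro τ hτ s
    have hτ' := hcte τ (Ioo_subset_Icc_self hτ)
    have hτI := hδsub (Ioo_subset_Icc_self hτ)
    have h1 := (hdtau τ hτI (cl a s) (hsubR _ (cl_mem ha.le s))).hasDerivAt (isOpen_Ioo.mem_nhds hτI)
    have hcp := hcpos τ s
    rw [hτ'] at hcp
    have h2 := (((hasDerivAt_const τ (cl a s)).div h1 hcp.ne').pow 2)
    have h3 : (fun τ => p τ s ^ 2) =ᶠ[𝓝 τ] ((fun _ => cl a s) / fun t => c t (cl a s)) ^ 2 := by
      filter_upwards [isOpen_Ioo.mem_nhds hτ] with t ht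
      simp only [hp, prof, Pi.pow_apply, Pi.div_apply]
      rw [hcte t (Ioo_subset_Icc_self ht)]
    refine (h2.congr_of_eventuallyEq h3).congr_deriv ?_
    simp only [hqd, hp, prof, Pi.div_apply]
    rw [hτ']
    simp
  obtain ⟨C, hCb⟩ := (isCompact_Icc.prod isCompact_Icc).exists_bound_of_continuousOn
    (s := Icc (τ0 - δ) (τ0 + δ) ×ˢ Icc a 1) hqdc.continuousOn
  have hqlip : ∀ τ ∈ Metric.ball τ0 δ, ∀ s ∈ Icc a 1, |p τ s ^ 2 - p τ0 s ^ 2| ≤ C * |τ - τ0| := by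
    intro τ hτ s hs
    rw [Real.ball_eq_Ioo] at hτ
    exact (convex_Ioo (τ0 - δ) (τ0 + δ)).norm_image_sub_le_of_norm_hasDerivWithin_le
      (f := fun τ => p τ s ^ 2) (fun t ht => (hqder t ht s).hasDerivWithinAt)
      (fun t ht => hCb (t, s) ⟨Ioo_subset_Icc_self ht, hs⟩) ⟨by linarith, by linarith⟩ hτ
  have hpos0 := hpos τ0 hτ0
  have hC0 := hC11 τ0 hτ0
  have hH0 := hHerg τ0 hτ0
  have hp0 : p τ0 = prof (c τ0) a := by simp only [hp]; rw [hct0]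
  obtain ⟨κ, hκ, hgr⟩ := prof_growth hRa.le ha0 ha hpos0 hC0 hH0
  rw [← hp0] at hgr
  have hmono : ∀ s t, a ≤ s → s < t → t ≤ 1 → p τ0 s < p τ0 t := fun s t h1 h2 h3 => by
    rw [hp0]; exact prof_lt hRa.le ha0 ha hpos0 hC0 hH0 h1 h2 h3
  set h : ℝ → ℝ := fun s => (cl a s)⁻¹ * (qd τ0 s / 2) with hh
  have hqd0 : Continuous (qd τ0) := hqdc.comp (by fun_prop : Continuous fun s : ℝ => (τ0, s))
  have hhc : Continuous h := by fun_prop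
  set f : ℝ → ℝ := fun r => ∫ s in a..1, h s * (√(p τ0 s ^ 2 - p τ0 r ^ 2))⁻¹ with hf
  have hFder : ∀ r ∈ Ioo a 1, HasDerivAt (fun τ => Fz (p τ) a (p τ0 r)) (f r) τ0 := by
    intro r hr
    have := deriv_sqrt_int (q := fun s => p τ0 s ^ 2) ha hκ ((hp1 τ0).pow 2) hgr (Ioo_subset_Icc_self hr)
      (g := fun s => (cl a s)⁻¹) hclinv (B := fun τ s => p τ s ^ 2 - p τ0 r ^ 2)
      (B' := fun s => qd τ0 s) (t0 := τ0) (C := C) (δ := δ) hδ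
      (fun t => by have := hp1 t; fun_prop) hqd0 (fun s => rfl)
      (by
        intro t ht s hs
        rw [sub_sub_sub_cancel_right]
        exact hqlip t ht s hs)
      (fun s hs => (hqder τ0 ⟨by linarith, by linarith⟩ s).sub_const _)
    unfold Fz
    refine this.congr_deriv ?_
    simp only [hf, hh]
    congr 1
    funext s
    ring
  -- local step
  have hloc : ∀ r1 r2, a < r1 → r1 < r2 → r2 < 1 → alphaFun (c τ0) r1 ≠ alphaFun (c τ0) r2 →
      ∃ r ∈ Ioo r1 r2, f r = 0 := by
    intro r1 r2 h1 h12 h2 hne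
    have hr1 : r1 ∈ Ioo a 1 := ⟨h1, h12.trans h2⟩
    have hr2 : r2 ∈ Ioo a 1 := ⟨h1.trans h12, h2⟩
    have hnn : ∀ r ∈ Ioo a 1, 0 ≤ alphaFun (c τ0) r := fun r hr =>
      alpha_nonneg (ha0.trans hr.1).le hr.2.le fun s hs => hpos0 s ⟨by linarith [hs.1, hr.1], hs.2⟩
    have hz12 : p τ0 r1 < p τ0 r2 := hmono r1 r2 h1.le h12 h2.le
    obtain ⟨x, σ, hσ, hx, hd1, hd2⟩ : ∃ (x : ℚ) (σ : ℝ), σ ≠ 0 ∧ 0 < x ∧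
        σ * (-alphaFun (c τ0) r1 + (x * Real.pi) * 1) < 0 ∧ 0 < σ * (-alphaFun (c τ0) r2 + (x * Real.pi) * 1) := by
      rcases lt_or_gt_of_ne hne with hl | hl
      · obtain ⟨x, hx1, hx2⟩ := exists_rat_btwn ((div_lt_div_iff_of_pos_right Real.pi_pos).2 hl)
        rw [div_lt_iff₀ Real.pi_pos] at hx1
        rw [lt_div_iff₀ Real.pi_pos] at hx2
        refine ⟨x, -1, by norm_num, ?_, by linarith, by linarith⟩
        have := hnn r1 hr1
        have h3 : (0:ℝ) < x := pos_of_mul_pos_left (by linarith) Real.pi_pos.le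
        exact_mod_cast h3
      · obtain ⟨x, hx1, hx2⟩ := exists_rat_btwn ((div_lt_div_iff_of_pos_right Real.pi_pos).2 hl)
        rw [div_lt_iff₀ Real.pi_pos] at hx1
        rw [lt_div_iff₀ Real.pi_pos] at hx2
        refine ⟨x, 1, by norm_num, ?_, by linarith, by linarith⟩
        have := hnn r2 hr2
        have h3 : (0:ℝ) < x := pos_of_mul_pos_left (by linarith) Real.pi_pos.le
        exact_mod_cast h3
    have hder : ∀ r ∈ Ioo a 1, HasDerivAt (fun z => σ * (Fz (p τ0) a z + (x * Real.pi) * z))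
        (σ * (-alphaFun (c τ0) r + (x * Real.pi) * 1)) (p τ0 r) := by
      intro r hr
      rw [hp0]
      exact ((Fz_deriv hRa.le ha0 ha hpos0 hC0 hH0 hr).add ((hasDerivAt_id _).const_mul (x * Real.pi))).const_mul σ
    have hden : (0:ℝ) < x.den := by exact_mod_cast x.den_pos
    obtain ⟨z0, hz0, hmin⟩ := envelope (H := fun τ z => σ * (Fz (p τ) a z + (x * Real.pi) * z))
      (by fun_prop) hz12 (hder r1 hr1) hd1 (hder r2 hr2) hd2
      (S := (fun y => 2 * (x.den : ℝ) * (y / σ)) ⁻¹' S)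
      (hS.preimage_of_injOn (by
        intro u _ v _ huv
        have h3 : (2 * (x.den : ℝ)) ≠ 0 := by positivity
        simpa [h3, hσ, div_left_inj'] using huv))
      (by
        have e1 : ∀ᶠ τ in 𝓝 τ0, p τ a < p τ0 r1 :=
          (hp2 a).continuousAt.eventually_lt continuousAt_const (hmono a r1 le_rfl h1 hr1.2.le)
        have e2 : ∀ᶠ τ in 𝓝 τ0, p τ0 r2 < p τ 1 :=
          continuousAt_const.eventually_lt (hp2 1).continuousAt (hmono r2 1 hr2.1.le h2 le_rfl)
        filter_upwards [e1, e2] with τ h3 h4 z hz hmin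
        rw [mem_preimage, mul_div_cancel_left₀ _ hσ]
        refine hlsp _ (hctI τ) ?_
        exact crit_mem_lsp hRa.le ha0 ha (hpos _ (hctI τ)) (hC11 _ (hctI τ)) (hHerg _ (hctI τ)) hσ hx
          (h3.trans hz.1) (hz.2.trans h4) hmin)
    obtain ⟨r, hr, rfl⟩ := intermediate_value_Ioo h12.le (hp1 τ0).continuousOn hz0
    refine ⟨r, hr, ?_⟩
    have h3 := hmin.hasDerivAt_eq_zero
      (((hFder r ⟨h1.trans hr.1, hr.2.trans h2⟩).add_const ((x * Real.pi) * p τ0 r)).const_mul σ)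
    exact (mul_eq_zero.1 h3).resolve_left hσ
  -- density and continuity
  have hzero : ∀ r ∈ Ioo a 1, f r = 0 := by
    intro r hr
    by_contra hne
    have hfc : ContinuousAt f r := abel_cont (q := fun s => p τ0 s ^ 2) ha0 hκ ((hp1 τ0).pow 2) hhc hgr hr
    have hev := (hfc.eventually_ne hne).and (isOpen_Ioo.mem_nhds hr)
    obtain ⟨η, hη, hball⟩ := Metric.eventually_nhds_iff_ball.1 hev
    rw [Real.ball_eq_Ioo] at hball
    have hlt : ∀ x ∈ Ioo (r - η) (r + η), ∀ y ∈ Ioo (r - η) (r + η), x < y → alphaFun (c τ0) x = alphaFun (c τ0) y := by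
      intro x hx y hy hxy
      by_contra hne2
      obtain ⟨t, ht, ht0⟩ := hloc x y (hball x hx).2.1 hxy (hball y hy).2.2 hne2
      exact (hball t ⟨hx.1.trans ht.1, ht.2.trans hy.2⟩).1 ht0
    have hco : ∀ x ∈ Ioo (r - η) (r + η), ∀ y ∈ Ioo (r - η) (r + η), alphaFun (c τ0) x = alphaFun (c τ0) y := by
      intro x hx y hy
      rcases lt_trichotomy x y with hxy | hxy | hxy
      · exact hlt x hx y hy hxy
      · rw [hxy]
      · exact (hlt y hy x hx hxy).symm
    have hcount : (Ioo (r - η) (r + η)).Countable := (hccc τ0 hτ0).mono fun x hx =>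
      by
      exact ⟨⟨hRa.trans (hball x hx).2.1, (hball x hx).2.2⟩, const_deriv isOpen_Ioo hco x hx⟩
    have hm := hcount.measure_zero volume
    rw [Real.volume_Ioo, ENNReal.ofReal_eq_zero] at hm
    linarith
  have hfin := abel_inj (q := fun s => p τ0 s ^ 2) hκ ((hp1 τ0).pow 2) hhc hgr hzero s0 ⟨has0, hs0.2⟩
  have hcl0 : cl a s0 = s0 := cl_eq ⟨has0.le, hs0.2.le⟩
  simp only [hh, hqd, hp, prof, hct0, hcl0] at hfin
  have hs0p : s0 ≠ 0 := (ha0.trans has0).ne'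
  have hcp := (hpos0 s0 (Ioo_subset_Icc_self hs0)).ne'
  simpa [hs0p, hcp] using hfin

theorem core2 {R ε : ℝ} (hR : R ∈ Ico (0:ℝ) 1) {c cdot : ℝ → ℝ → ℝ} {S : Set ℝ} (hS : S.Countable)
    (hpos : ∀ τ ∈ Ioo (-ε) ε, ∀ r ∈ Icc R 1, 0 < c τ r)
    (hC11 : ∀ τ ∈ Ioo (-ε) ε, IsC11On (c τ) R)
    (hHerg : ∀ τ ∈ Ioo (-ε) ε, HerglotzCond (c τ) R)
    (hccc : ∀ τ ∈ Ioo (-ε) ε, {r | r ∈ Ioo R 1 ∧ deriv (alphaFun (c τ)) r = 0}.Countable)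
    (hcont : ContinuousOn (fun p : ℝ × ℝ => c p.1 p.2) (Ioo (-ε) ε ×ˢ Icc R 1))
    (hdtau : ∀ τ ∈ Ioo (-ε) ε, ∀ r ∈ Icc R 1, HasDerivWithinAt (fun t => c t r) (cdot τ r) (Ioo (-ε) ε) τ)
    (hdcont : ContinuousOn (fun p : ℝ × ℝ => cdot p.1 p.2) (Ioo (-ε) ε ×ˢ Icc R 1))
    (hlsp : ∀ τ ∈ Ioo (-ε) ε, lsp (c τ) R ⊆ S) :
    ∀ τ ∈ Ioo (-ε) ε, ∀ r ∈ Icc R 1, c τ r = c 0 r := by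
  have h0 := core hR hS hpos hC11 hHerg hccc hcont hdtau hdcont hlsp
  intro τ hτ
  have hz : (0:ℝ) ∈ Ioo (-ε) ε := ⟨by linarith [hτ.1, hτ.2], by linarith [hτ.1, hτ.2]⟩
  have hoo : EqOn (c τ) (c 0) (Ioo R 1) := by
    intro r hr
    have hr' := Ioo_subset_Icc_self hr
    have := (convex_Ioo (-ε) ε).norm_image_sub_le_of_norm_hasDerivWithin_le (C := 0)
      (f := fun t => c t r) (fun t ht => hdtau t ht r hr') (fun t ht => by rw [h0 t ht r hr]; simp) hz hτ
    rw [zero_mul] at this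
    exact sub_eq_zero.1 (norm_le_zero_iff.1 this)
  have := hoo.of_subset_closure (C11_cont (hC11 τ hτ) le_rfl) (C11_cont (hC11 0 hz) le_rfl) Ioo_subset_Icc_self
    (by rw [closure_Ioo hR.2.ne])
  exact fun r hr => this hr

end HelperProofs

theorem stmt13 (N N' : ℕ) (hNN' : 1 ≤ N + N')
    (R : Fin N → ℝ) (hR : ∀ i, R i ∈ Set.Ico (0:ℝ) 1)
    (R' : Fin N' → ℝ) (hR' : ∀ j, R' j ∈ Set.Ioo (0:ℝ) 1)
    (ε : ℝ) (hε : 0 < ε)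
    (c : Fin N → ℝ → ℝ → ℝ) (cdot : Fin N → ℝ → ℝ → ℝ)
    (c' : Fin N' → ℝ → ℝ → ℝ) (c'dot : Fin N' → ℝ → ℝ → ℝ)
    (hpos : ∀ i, ∀ τ ∈ Set.Ioo (-ε) ε, ∀ r ∈ Set.Icc (R i) 1, 0 < c i τ r)
    (hC11 : ∀ i, ∀ τ ∈ Set.Ioo (-ε) ε, IsC11On (c i τ) (R i))
    (hHerg : ∀ i, ∀ τ ∈ Set.Ioo (-ε) ε, HerglotzCond (c i τ) (R i))
    (hccc : ∀ i, ∀ τ ∈ Set.Ioo (-ε) ε,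
      {r | r ∈ Set.Ioo (R i) 1 ∧ deriv (alphaFun (c i τ)) r = 0}.Countable)
    (hcont : ∀ i, ContinuousOn (fun p : ℝ × ℝ => c i p.1 p.2)
      (Set.Ioo (-ε) ε ×ˢ Set.Icc (R i) 1))
    (hdtau : ∀ i, ∀ τ ∈ Set.Ioo (-ε) ε, ∀ r ∈ Set.Icc (R i) 1,
      HasDerivWithinAt (fun t => c i t r) (cdot i τ r) (Set.Ioo (-ε) ε) τ)
    (hdcont : ∀ i, ContinuousOn (fun p : ℝ × ℝ => cdot i p.1 p.2)
      (Set.Ioo (-ε) ε ×ˢ Set.Icc (R i) 1))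
    (hR0 : ∀ i, R i = 0 → ∀ τ ∈ Set.Ioo (-ε) ε,
      derivWithin (c i τ) (Set.Icc (R i) 1) 0 = 0)
    (hpos' : ∀ j, ∀ τ ∈ Set.Ioo (-ε) ε, ∀ r ∈ Set.Icc (R' j) 1, 0 < c' j τ r)
    (hC11' : ∀ j, ∀ τ ∈ Set.Ioo (-ε) ε, IsC11On (c' j τ) (R' j))
    (hHerg' : ∀ j, ∀ τ ∈ Set.Ioo (-ε) ε, HerglotzCond (c' j τ) (R' j))
    (hccc' : ∀ j, ∀ τ ∈ Set.Ioo (-ε) ε,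
      {r | r ∈ Set.Ioo (R' j) 1 ∧ deriv (alphaFun (c' j τ)) r = 0}.Countable)
    (hcont' : ∀ j, ContinuousOn (fun p : ℝ × ℝ => c' j p.1 p.2)
      (Set.Ioo (-ε) ε ×ˢ Set.Icc (R' j) 1))
    (hdtau' : ∀ j, ∀ τ ∈ Set.Ioo (-ε) ε, ∀ r ∈ Set.Icc (R' j) 1,
      HasDerivWithinAt (fun t => c' j t r) (c'dot j τ r) (Set.Ioo (-ε) ε) τ)
    (hdcont' : ∀ j, ContinuousOn (fun p : ℝ × ℝ => c'dot j p.1 p.2)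
      (Set.Ioo (-ε) ε ×ˢ Set.Icc (R' j) 1))
    (hlsp : ∀ τ ∈ Set.Ioo (-ε) ε,
      (⋃ i, lsp (c i τ) (R i)) ∪ (⋃ j, lsp' (c' j τ) (R' j)) =
      (⋃ i, lsp (c i 0) (R i)) ∪ (⋃ j, lsp' (c' j 0) (R' j))) :
    (∀ i, ∀ τ ∈ Set.Ioo (-ε) ε, ∀ r ∈ Set.Icc (R i) 1, c i τ r = c i 0 r) ∧
    (∀ j, ∀ τ ∈ Set.Ioo (-ε) ε, ∀ r ∈ Set.Icc (R' j) 1, c' j τ r = c' j 0 r) := by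
  have hz : (0:ℝ) ∈ Set.Ioo (-ε) ε := ⟨by linarith, hε⟩
  have hScount : ((⋃ i, lsp (c i 0) (R i)) ∪ (⋃ j, lsp' (c' j 0) (R' j))).Countable := by
    refine (Set.countable_iUnion fun i => HelperProofs.lsp_countable (hccc i 0 hz)).union
      (Set.countable_iUnion fun j => HelperProofs.lsp'_countable (hR' j) (hpos' j 0 hz) (hC11' j 0 hz)
        (hHerg' j 0 hz) (hccc' j 0 hz))
  constructor
  · intro i
    refine HelperProofs.core2 (hR i) hScount (hpos i) (hC11 i) (hHerg i) (hccc i) (hcont i) (hdtau i) (hdcont i) ?_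
    intro τ hτ
    rw [← hlsp τ hτ]
    exact (Set.subset_iUnion (fun i => lsp (c i τ) (R i)) i).trans Set.subset_union_left
  · intro j
    refine HelperProofs.core2 ⟨(hR' j).1.le, (hR' j).2⟩ hScount (hpos' j) (hC11' j) (hHerg' j) (hccc' j)
      (hcont' j) (hdtau' j) (hdcont' j) ?_
    intro τ hτ
    rw [← hlsp τ hτ]
    refine Set.Subset.trans ?_ ((Set.subset_iUnion (fun j => lsp' (c' j τ) (R' j)) j).trans Set.subset_union_right)
    exact Set.subset_union_left
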